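/- arXiv:2504.09576 — 3 statements merged into one kernel-verified Lean document; each statement's English description precedes it below -/
import Mathlib

section
/- Let (Φ_t)_{t≥0} be a quantum Markov semigroup on the algebra M_n(ℂ) of complex n×n matrices. Then there exist a linear map L on M_n(ℂ) with Φ_t = exp(−tL) for all t ≥ 0, finitely many matrices v_1, …, v_m ∈ M_n(ℂ) with τ(v_j) = 0 and τ(v_j v_k*) = (1/n)·δ_{jk} for all j,k, nonnegative real numbers ω_1, …, ω_m, and a hermitian matrix w ∈ M_n(ℂ), such that for every x ∈ M_n(ℂ): L(x) = Σ_{j=1}^m ( (ω_j/2)(v_j* v_j x + x v_j* v_j) − ω_j v_j* x v_j ) + i(w x − x w). -/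
open Matrix
open scoped ComplexOrder

noncomputable section

/-- `Mat n` is the algebra of complex `n × n` matrices. -/
abbrev Mat (n : ℕ) : Type := Matrix (Fin n) (Fin n) ℂ

/-- Blockwise application of a linear map on `Mat n` to a `k × k` block matrix with
`n × n` blocks (i.e. the map `Φ ⊗ id_k`). -/
def blockMap (n k : ℕ) (Φ : Mat n →ₗ[ℂ] Mat n)
    (X : Matrix (Fin k × Fin n) (Fin k × Fin n) ℂ) :
    Matrix (Fin k × Fin n) (Fin k × Fin n) ℂ :=
  Matrix.of fun p q => Φ (Matrix.of fun i j => X (p.1, i) (q.1, j)) p.2 q.2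

/-- A linear map on `Mat n` is completely positive if its blockwise application to any
positive semidefinite `k × k` block matrix is positive semidefinite. -/
def IsCompletelyPositive (n : ℕ) (Φ : Mat n →ₗ[ℂ] Mat n) : Prop :=
  ∀ k : ℕ, 1 ≤ k → ∀ X : Matrix (Fin k × Fin n) (Fin k × Fin n) ℂ,
    X.PosSemidef → (blockMap n k Φ X).PosSemidef

/-- A quantum channel is a unital completely positive linear map. -/
def IsQuantumChannel (n : ℕ) (Φ : Mat n →ₗ[ℂ] Mat n) : Prop :=
  IsCompletelyPositive n Φ ∧ Φ 1 = 1

/-- A quantum Markov semigroup on `Mat n`. -/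
def IsQMS (n : ℕ) (Φ : ℝ → (Mat n →ₗ[ℂ] Mat n)) : Prop :=
  (∀ t : ℝ, 0 ≤ t → IsQuantumChannel n (Φ t)) ∧
  Φ 0 = LinearMap.id ∧
  (∀ s t : ℝ, 0 ≤ s → 0 ≤ t → Φ (s + t) = (Φ s).comp (Φ t)) ∧
  (∀ x : Mat n, Continuous fun t : ℝ => Φ t x)

/-- The standard basis of `Mat n`, indexed by matrix entries. -/
def matBasis (n : ℕ) : Module.Basis (Fin n × Fin n) ℂ (Mat n) := Matrix.stdBasis ℂ (Fin n) (Fin n)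

/-- The exponential of a linear operator on the finite-dimensional space `Mat n`,
computed via the matrix exponential of its matrix in the standard basis. -/
def expEnd (n : ℕ) (L : Mat n →ₗ[ℂ] Mat n) : Mat n →ₗ[ℂ] Mat n :=
  Matrix.toLin (matBasis n) (matBasis n)
    (NormedSpace.exp (LinearMap.toMatrix (matBasis n) (matBasis n) L))

/-- The normalized trace `τ = Tr / n` on `Mat n`. -/
def ntrace (n : ℕ) (x : Mat n) : ℂ := (n : ℂ)⁻¹ * x.trace

/-- A norm-continuous one-parameter semigroup in a Banach algebra is an exponential. -/
theorem exists_eq_exp_smul_of_continuous_semigroup {𝔸 : Type*} [NormedRing 𝔸] [NormedAlgebra ℝ 𝔸]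
    [CompleteSpace 𝔸] {S : ℝ → 𝔸} (hc : Continuous S) (h0 : S 0 = 1)
    (hadd : ∀ s t : ℝ, 0 ≤ s → 0 ≤ t → S (s + t) = S s * S t) :
    ∃ A : 𝔸, ∀ t : ℝ, 0 ≤ t → S t = NormedSpace.exp (t • A) := by
  set V : ℝ → 𝔸 := fun u => ∫ s in (0 : ℝ)..u, S s with hV
  have hVd : ∀ u, HasDerivAt V (S u) u := fun u => (hc.integral_hasStrictDerivAt 0 u).hasDerivAt
  obtain ⟨h, hpos, hunit⟩ : ∃ h : ℝ, 0 < h ∧ IsUnit (V h) := by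
    have h1 : Filter.Tendsto (slope V 0) (nhdsWithin 0 {0}ᶜ) (nhds 1) := by
      simpa [h0] using hasDerivAt_iff_tendsto_slope.mp (hVd 0)
    have h2 : ∀ᶠ x in nhdsWithin (0 : ℝ) (Set.Ioi 0), IsUnit (slope V 0 x) :=
      (h1.mono_left (nhdsWithin_mono 0 fun x (hx : 0 < x) => hx.ne')).eventually
        (Units.isOpen.mem_nhds isUnit_one)
    obtain ⟨x, hx, hx0⟩ := (h2.and self_mem_nhdsWithin).exists
    have hx0' : (0 : ℝ) < x := hx0
    refine ⟨x, hx0', ?_⟩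
    have : V x = (x • (1 : 𝔸)) * slope V 0 x := by
      simp [slope, hV, smul_smul, hx0'.ne']
    rw [this]
    refine IsUnit.mul ?_ hx
    exact ⟨⟨x • 1, x⁻¹ • 1, by simp [smul_smul, hx0'.ne'], by simp [smul_smul, hx0'.ne']⟩, rfl⟩
  obtain ⟨U, hU⟩ := hunit
  set A : 𝔸 := (S h - 1) * ((U⁻¹ : 𝔸ˣ) : 𝔸) with hA
  set W : ℝ → 𝔸 := fun t => (V (t + h) - V t) * ((U⁻¹ : 𝔸ˣ) : 𝔸) with hW
  have hSW : ∀ t, 0 ≤ t → W t = S t := by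
    intro t ht
    have h1 : V (t + h) - V t = S t * V h := by
      have e1 : V (t + h) - V t = ∫ s in t..(t + h), S s :=
        intervalIntegral.integral_interval_sub_left (hc.intervalIntegrable _ _)
          (hc.intervalIntegrable _ _)
      have e2 : S t * V h = ∫ s in (0 : ℝ)..h, S t * S s :=
        ((ContinuousLinearMap.mul ℝ 𝔸 (S t)).intervalIntegral_comp_comm
          (hc.intervalIntegrable 0 h)).symm
      have e3 : ∫ s in (0 : ℝ)..h, S t * S s = ∫ s in (0 : ℝ)..h, S (t + s) := by
        refine intervalIntegral.integral_congr fun s hs => ?_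
        rw [Set.uIcc_of_le hpos.le] at hs
        exact (hadd t s ht hs.1).symm
      rw [e1, e2, e3, intervalIntegral.integral_comp_add_left]
      simp
    simp only [hW, h1, ← hU, Units.mul_inv_cancel_right]
  have hWd : ∀ t, 0 ≤ t → HasDerivAt W (W t * A) t := by
    intro t ht
    have h1 : HasDerivAt W ((S (t + h) - S t) * ((U⁻¹ : 𝔸ˣ) : 𝔸)) t :=
      (((hVd (t + h)).comp_add_const t h).sub (hVd t)).mul_const _
    convert h1 using 1
    rw [hSW t ht, hadd t h ht hpos.le, hA]
    noncomm_ring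
  have hG : ∀ t, 0 ≤ t → HasDerivAt (fun u : ℝ => W u * NormedSpace.exp (u • (-A))) 0 t := by
    intro t ht
    have hmul := (hWd t ht).mul (hasDerivAt_exp_smul_const' (𝕂 := ℝ) (-A) t)
    exact hmul.congr_deriv (by noncomm_ring)
  refine ⟨A, fun t ht => ?_⟩
  have hconst := constant_of_has_deriv_right_zero (a := 0) (b := t)
    (fun x hx => (hG x hx.1).continuousAt.continuousWithinAt)
    (fun x hx => (hG x hx.1).hasDerivWithinAt) t ⟨ht, le_rfl⟩
  simp only [hSW t ht, hSW 0 le_rfl, h0, zero_smul, NormedSpace.exp_zero, one_mul] at hconst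
  let _ : NormedAlgebra ℚ 𝔸 := NormedAlgebra.restrictScalars ℚ ℝ 𝔸
  have hinv : NormedSpace.exp (t • (-A)) * NormedSpace.exp (t • A) = 1 := by
    rw [← NormedSpace.exp_add_of_commute (by simp)]
    simp
  calc S t = S t * (NormedSpace.exp (t • (-A)) * NormedSpace.exp (t • A)) := by rw [hinv, mul_one]
    _ = _ := by rw [← mul_assoc, hconst, one_mul]

/-- Entries of a hermitian matrix in terms of its spectral decomposition. -/
theorem Matrix.IsHermitian.apply_eq_sum_eigenvectorBasis {ι : Type*} [Fintype ι] [DecidableEq ι]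
    {M : Matrix ι ι ℂ} (hM : M.IsHermitian) (p q : ι) :
    M p q = ∑ j, (hM.eigenvalues j : ℂ) *
      ((hM.eigenvectorBasis j).ofLp p * star ((hM.eigenvectorBasis j).ofLp q)) := by
  conv_lhs => rw [hM.spectral_theorem, Unitary.conjStarAlgAut_apply]
  rw [Matrix.mul_apply]
  refine Finset.sum_congr rfl fun j _ => ?_
  rw [Matrix.mul_diagonal, Matrix.star_apply]
  simp
  ring

/-- A hermitian matrix that is positive on the orthogonal complement of `e` is, up to rank-one
terms involving `e`, positive semidefinite with `e` in its kernel. -/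
theorem exists_posSemidef_add_vecMulVec {ι : Type*} [Fintype ι] [DecidableEq ι]
    {D : Matrix ι ι ℂ} (hD : D.IsHermitian) {e : ι → ℂ} (he : e ≠ 0)
    (hpos : ∀ x : ι → ℂ, star e ⬝ᵥ x = 0 → 0 ≤ star x ⬝ᵥ (D *ᵥ x)) :
    ∃ (M : Matrix ι ι ℂ) (y : ι → ℂ), M.PosSemidef ∧ M *ᵥ e = 0 ∧
      D = M + vecMulVec e (star y) + vecMulVec y (star e) := by
  set c : ℂ := star e ⬝ᵥ e with hc
  have hc0 : c ≠ 0 := by simpa [hc, dotProduct_star_self_eq_zero] using he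
  have hcs : star c = c := (star_dotProduct e e).symm
  set Q : Matrix ι ι ℂ := c⁻¹ • vecMulVec e (star e) with hQ
  have hQH : Qᴴ = Q := by
    simp [hQ, conjTranspose_smul, conjTranspose_vecMulVec, hcs]
  have hQe : Q *ᵥ e = e := by
    simp [hQ, smul_mulVec, vecMulVec_mulVec, ← hc, hc0, smul_smul]
  have heQ : star e ᵥ* Q = star e := by
    have := congrArg star hQe
    rwa [star_mulVec, hQH] at this
  set d : ℂ := star e ⬝ᵥ (D *ᵥ e) with hd
  have hds : star d = d := by
    rw [hd, ← star_dotProduct, star_mulVec, hD.eq, ← dotProduct_mulVec]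
  refine ⟨(1 - Q)ᴴ * D * (1 - Q), c⁻¹ • (D *ᵥ e) - (c⁻¹ * c⁻¹ * d / 2) • e, ?_, ?_, ?_⟩
  · refine PosSemidef.of_dotProduct_mulVec_nonneg (isHermitian_conjTranspose_mul_mul _ hD) ?_
    intro x
    have := hpos ((1 - Q) *ᵥ x) (by
      rw [dotProduct_mulVec, vecMul_sub, vecMul_one, heQ, sub_self, zero_dotProduct])
    rwa [star_mulVec, ← dotProduct_mulVec, mulVec_mulVec, mulVec_mulVec] at this
  · rw [← mulVec_mulVec, sub_mulVec, hQe, one_mulVec, sub_self, mulVec_zero]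
  · have hQD : Q * D = c⁻¹ • vecMulVec e (star (D *ᵥ e)) := by
      rw [hQ, smul_mul, vecMulVec_mul, star_mulVec, hD.eq]
    have hDQ : D * Q = c⁻¹ • vecMulVec (D *ᵥ e) (star e) := by
      rw [hQ, Matrix.mul_smul, mul_vecMulVec]
    have hQDQ : Q * D * Q = (c⁻¹ * c⁻¹ * d) • vecMulVec e (star e) := by
      rw [mul_assoc, hDQ, hQ, smul_mul_smul_comm, vecMulVec_mul_vecMulVec, ← hd, vecMulVec_smul,
        smul_smul]
    have hexp : (1 - Q)ᴴ * D * (1 - Q) = D - Q * D - D * Q + Q * D * Q := by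
      rw [conjTranspose_sub, hQH, conjTranspose_one]
      noncomm_ring
    have hcis : star c⁻¹ = c⁻¹ := by rw [star_inv₀, hcs]
    have hk : star (c⁻¹ * c⁻¹ * d / 2) = c⁻¹ * c⁻¹ * d / 2 := by
      rw [star_div₀, star_mul', star_mul', hcis, hds]
      simp
    rw [hexp, hQDQ, hQD, hDQ, star_sub, star_smul, star_smul, hk, hcis]
    ext i j
    simp [vecMulVec_apply]
    ring

theorem Matrix.tendsto_inv_smul_exp_sub_one {ι : Type*} [Fintype ι] [DecidableEq ι]
    (A : Matrix ι ι ℂ) :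
    Filter.Tendsto (fun t : ℝ => t⁻¹ • (NormedSpace.exp (t • A) - 1))
      (nhdsWithin 0 (Set.Ioi 0)) (nhds A) := by
  open scoped Norms.Operator in
    (have h := (hasDerivAt_exp_smul_const (𝕂 := ℝ) A 0).tendsto_slope_zero_right
     simp only [zero_add, zero_smul, NormedSpace.exp_zero, one_mul] at h
     exact h)

theorem Matrix.exists_eq_exp_smul_of_continuous_semigroup {ι : Type*} [Fintype ι] [DecidableEq ι]
    {S : ℝ → Matrix ι ι ℂ} (hc : Continuous S) (h0 : S 0 = 1)
    (hadd : ∀ s t : ℝ, 0 ≤ s → 0 ≤ t → S (s + t) = S s * S t) :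
    ∃ A : Matrix ι ι ℂ, ∀ t : ℝ, 0 ≤ t → S t = NormedSpace.exp (t • A) := by
  open scoped Norms.Operator in
    exact _root_.exists_eq_exp_smul_of_continuous_semigroup hc h0 hadd

/-- The matrix of a linear map on `Mat n` in the standard basis, reshuffled into the Choi matrix. -/
def choi {n : ℕ} (A : Matrix (Fin n × Fin n) (Fin n × Fin n) ℂ) :
    Matrix (Fin n × Fin n) (Fin n × Fin n) ℂ :=
  Matrix.of fun p q => A (p.2, q.2) (p.1, q.1)

/-- The unnormalized maximally entangled vector. -/
def entangled (n : ℕ) : Fin n × Fin n → ℂ := fun p => if p.1 = p.2 then 1 else 0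

theorem continuous_choi (n : ℕ) : Continuous (choi (n := n)) :=
  continuous_matrix fun _ _ => continuous_id.matrix_elem _ _

theorem toMatrix_matBasis_apply {n : ℕ} (T : Mat n →ₗ[ℂ] Mat n) (p q : Fin n × Fin n) :
    LinearMap.toMatrix (matBasis n) (matBasis n) T p q = T (Matrix.single q.1 q.2 1) p.1 p.2 := by
  rw [LinearMap.toMatrix_apply, matBasis, ← Prod.mk.eta (p := q), Matrix.stdBasis_eq_single]
  simp [Matrix.stdBasis]

theorem apply_eq_sum_single {n : ℕ} (T : Mat n →ₗ[ℂ] Mat n) (x : Mat n) (i j : Fin n) :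
    T x i j = ∑ a, ∑ b, x a b * T (Matrix.single a b 1) i j := by
  conv_lhs => rw [Matrix.matrix_eq_sum_single x]
  simp only [map_sum, Matrix.sum_apply]
  refine Finset.sum_congr rfl fun a _ => Finset.sum_congr rfl fun b _ => ?_
  rw [← mul_one (x a b), ← smul_eq_mul, ← Matrix.smul_single, map_smul, Matrix.smul_apply]
  simp

theorem conjTranspose_mul_mul_apply {n : ℕ} (V x W : Mat n) (i j : Fin n) :
    (Vᴴ * x * W) i j = ∑ a, ∑ b, x a b * (star (V a i) * W b j) := by
  simp only [Matrix.mul_apply, Finset.sum_mul, Matrix.conjTranspose_apply]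
  rw [Finset.sum_comm]
  refine Finset.sum_congr rfl fun a _ => Finset.sum_congr rfl fun b _ => ?_
  ring

theorem choi_one (n : ℕ) :
    choi (1 : Matrix (Fin n × Fin n) (Fin n × Fin n) ℂ)
      = vecMulVec (entangled n) (star (entangled n)) := by
  ext p q
  simp only [choi, entangled, Matrix.of_apply, Matrix.one_apply, vecMulVec_apply, Pi.star_apply,
    Prod.mk.injEq]
  by_cases h1 : p.1 = p.2 <;> by_cases h2 : q.1 = q.2 <;> simp [h1, h2, eq_comm]

theorem IsCompletelyPositive.posSemidef_choi {n : ℕ} (hn : 0 < n) {T : Mat n →ₗ[ℂ] Mat n}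
    (hT : IsCompletelyPositive n T) :
    (choi (LinearMap.toMatrix (matBasis n) (matBasis n) T)).PosSemidef := by
  have h := hT n hn _ (posSemidef_vecMulVec_self_star (entangled n))
  convert h using 1
  ext p q
  simp only [choi, blockMap, Matrix.of_apply, toMatrix_matBasis_apply]
  refine congrArg (fun z => T z p.2 q.2) (Matrix.ext fun i j => ?_)
  simp only [Matrix.single_apply, entangled, Matrix.of_apply, vecMulVec_apply, Pi.star_apply]
  by_cases h1 : p.1 = i <;> by_cases h2 : q.1 = j <;> simp [h1, h2]

/-- The generator of a quantum Markov semigroup, as a matrix in the standard basis: its Choi matrix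
is hermitian and conditionally positive, and it annihilates the identity. -/
theorem IsQMS.exists_generator {n : ℕ} (hn : 0 < n) {Φ : ℝ → (Mat n →ₗ[ℂ] Mat n)}
    (hΦ : IsQMS n Φ) :
    ∃ A : Matrix (Fin n × Fin n) (Fin n × Fin n) ℂ,
      (∀ t : ℝ, 0 ≤ t →
        LinearMap.toMatrix (matBasis n) (matBasis n) (Φ t) = NormedSpace.exp (t • A)) ∧
      (choi A).IsHermitian ∧
      (∀ x, star (entangled n) ⬝ᵥ x = 0 → 0 ≤ star x ⬝ᵥ (choi A *ᵥ x)) ∧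
      Matrix.toLin (matBasis n) (matBasis n) A 1 = 0 := by
  obtain ⟨hch, h0, hadd, hcont⟩ := hΦ
  obtain ⟨A, hA⟩ := Matrix.exists_eq_exp_smul_of_continuous_semigroup
    (S := fun t => LinearMap.toMatrix (matBasis n) (matBasis n) (Φ t))
    (continuous_matrix fun p q => by
      simp only [toMatrix_matBasis_apply]
      exact (hcont _).matrix_elem _ _)
    (by simp [h0])
    (fun s t hs ht => by
      simp only [hadd s t hs ht]
      rw [LinearMap.toMatrix_comp _ (matBasis n)])
  have hlim := Matrix.tendsto_inv_smul_exp_sub_one A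
  have hchoi := ((continuous_choi n).tendsto A).comp hlim
  have hdiff : ∀ t : ℝ, 0 < t → choi (t⁻¹ • (NormedSpace.exp (t • A) - 1)) =
      t⁻¹ • (choi (LinearMap.toMatrix (matBasis n) (matBasis n) (Φ t))
        - vecMulVec (entangled n) (star (entangled n))) := fun t ht => by
    rw [hA t ht.le, ← choi_one]
    rfl
  refine ⟨A, hA, ?_, ?_, ?_⟩
  · refine tendsto_nhds_unique ((continuous_id.matrix_conjTranspose.tendsto (choi A)).comp hchoi)
      (hchoi.congr' ?_)
    filter_upwards [self_mem_nhdsWithin] with t ht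
    have hH : (choi (t⁻¹ • (NormedSpace.exp (t • A) - 1))).IsHermitian := by
      rw [hdiff t ht, IsHermitian, conjTranspose_smul, conjTranspose_sub,
        ((hch t (le_of_lt ht)).1.posSemidef_choi hn).1.eq,
        (posSemidef_vecMulVec_self_star (entangled n)).1.eq, star_trivial]
    exact hH.eq.symm
  · intro x hx
    have hq : Filter.Tendsto (fun t : ℝ => star x ⬝ᵥ
        (choi (t⁻¹ • (NormedSpace.exp (t • A) - 1)) *ᵥ x)) (nhdsWithin 0 (Set.Ioi 0))
        (nhds (star x ⬝ᵥ (choi A *ᵥ x))) :=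
      ((continuous_const.dotProduct (continuous_id.matrix_mulVec continuous_const)).tendsto
        (choi A)).comp hchoi
    refine ge_of_tendsto hq ?_
    filter_upwards [self_mem_nhdsWithin] with t ht
    have ht' : (0 : ℝ) < t := ht
    rw [hdiff t ht', smul_mulVec, dotProduct_smul, sub_mulVec, vecMulVec_mulVec, hx]
    simp only [MulOpposite.op_zero, zero_smul, sub_zero]
    exact smul_nonneg (inv_nonneg.mpr ht'.le)
      (((hch t ht'.le).1.posSemidef_choi hn).dotProduct_mulVec_nonneg x)
  · have hv : Filter.Tendsto (fun t : ℝ => (t⁻¹ • (NormedSpace.exp (t • A) - 1)) *ᵥ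
        (matBasis n).repr 1) (nhdsWithin 0 (Set.Ioi 0)) (nhds (A *ᵥ (matBasis n).repr 1)) :=
      ((continuous_id.matrix_mulVec continuous_const).tendsto A).comp hlim
    have hz : A *ᵥ (matBasis n).repr 1 = 0 := by
      refine tendsto_nhds_unique hv (tendsto_const_nhds.congr' ?_)
      filter_upwards [self_mem_nhdsWithin] with t ht
      rw [← hA t (le_of_lt ht), smul_mulVec, sub_mulVec, LinearMap.toMatrix_mulVec_repr,
        (hch t (le_of_lt ht)).2, one_mulVec, sub_self, smul_zero]
    rw [Matrix.toLin_apply]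
    simp [hz]

/-- Kraus-type form of a linear map read off from a decomposition of its Choi matrix. -/
theorem apply_eq_sum_of_choi_eq {n : ℕ} {A M : Matrix (Fin n × Fin n) (Fin n × Fin n) ℂ}
    {y : Fin n × Fin n → ℂ} (hM : M.IsHermitian)
    (hA : choi A = M + vecMulVec (entangled n) (star y) + vecMulVec y (star (entangled n)))
    (x : Mat n) :
    Matrix.toLin (matBasis n) (matBasis n) A x =
      (∑ l, (hM.eigenvalues l : ℂ) •
        ((Matrix.of fun a i => star ((hM.eigenvectorBasis l).ofLp (a, i)) : Mat n)ᴴ * x *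
          (Matrix.of fun a i => star ((hM.eigenvectorBasis l).ofLp (a, i)) : Mat n))) +
      (x * (Matrix.of fun a i => star (y (a, i)) : Mat n) +
        (Matrix.of fun a i => star (y (a, i)) : Mat n)ᴴ * x) := by
  set K : Mat n := Matrix.of fun a i => star (y (a, i)) with hK
  have hentry : ∀ a b i j, Matrix.toLin (matBasis n) (matBasis n) A (Matrix.single a b 1) i j =
      choi A (a, i) (b, j) := fun a b i j => by
    simpa [choi] using (toMatrix_matBasis_apply
      (Matrix.toLin (matBasis n) (matBasis n) A) (i, j) (a, b)).symm
  have h1 : x * K = (1 : Mat n)ᴴ * x * K := by simp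
  have h2 : Kᴴ * x = Kᴴ * x * 1 := by simp
  ext i j
  rw [apply_eq_sum_single, h1, h2, Matrix.add_apply, Matrix.add_apply, Matrix.sum_apply]
  simp only [Matrix.smul_apply, conjTranspose_mul_mul_apply, hentry, smul_eq_mul, Finset.mul_sum]
  have hcomm : ∀ F : Fin n × Fin n → Fin n → Fin n → ℂ,
      ∑ l, ∑ a, ∑ b, F l a b = ∑ a, ∑ b, ∑ l, F l a b := fun F => by
    rw [Finset.sum_comm]
    exact Finset.sum_congr rfl fun a _ => Finset.sum_comm
  rw [hcomm]
  simp only [← Finset.sum_add_distrib]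
  refine Finset.sum_congr rfl fun a _ => Finset.sum_congr rfl fun b _ => ?_
  rw [hA, Matrix.add_apply, Matrix.add_apply, hM.apply_eq_sum_eigenvectorBasis, add_assoc, mul_add,
    mul_add, Finset.mul_sum]
  congr 1
  · refine Finset.sum_congr rfl fun l _ => ?_
    simp only [Matrix.of_apply, star_star]
    ring
  · simp only [vecMulVec_apply, entangled, hK, Matrix.one_apply, Matrix.of_apply, Pi.star_apply,
      star_star]
    split_ifs <;> simp

/-- **Lindblad form of the generator of a quantum Markov semigroup.**
Every quantum Markov semigroup `(Φ_t)_{t ≥ 0}` on `M_n(ℂ)` is of the form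
`Φ_t = exp (−t L)` where `L(x) = Σ_j ( (ω_j/2)(v_j* v_j x + x v_j* v_j) − ω_j v_j* x v_j )
+ i (w x − x w)` with `τ(v_j) = 0`, `τ(v_j v_k*) = (1/n) δ_{jk}`, `ω_j ≥ 0`, and `w`
hermitian. -/
theorem lindblad_form {n : ℕ} (hn : 0 < n) (Φ : ℝ → (Mat n →ₗ[ℂ] Mat n))
    (hΦ : IsQMS n Φ) :
    ∃ (L : Mat n →ₗ[ℂ] Mat n) (m : ℕ) (v : Fin m → Mat n) (ω : Fin m → ℝ) (w : Mat n),
      (∀ t : ℝ, 0 ≤ t → Φ t = expEnd n (-((t : ℂ) • L))) ∧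
      (∀ j, ntrace n (v j) = 0) ∧
      (∀ j k, ntrace n (v j * (v k)ᴴ) = if j = k then (n : ℂ)⁻¹ else 0) ∧
      (∀ j, 0 ≤ ω j) ∧
      wᴴ = w ∧
      (∀ x : Mat n,
        L x = (∑ j, (((ω j : ℂ) / 2) • ((v j)ᴴ * v j * x + x * ((v j)ᴴ * v j))
                      - (ω j : ℂ) • ((v j)ᴴ * x * v j)))
              + Complex.I • (w * x - x * w)) := by
  obtain ⟨A, hA, hH, hpos, hone⟩ := hΦ.exists_generator hn
  have he : entangled n ≠ 0 := fun h => by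
    simpa [entangled] using congrFun h (⟨0, hn⟩, ⟨0, hn⟩)
  obtain ⟨M, y, hM, hMe, hC⟩ := exists_posSemidef_add_vecMulVec hH he hpos
  have hT := apply_eq_sum_of_choi_eq hM.1 hC
  set μ := hM.1.eigenvalues
  set u := hM.1.eigenvectorBasis
  set V : Fin n × Fin n → Mat n := fun l => Matrix.of fun a i => star ((u l).ofLp (a, i)) with hV
  set K : Mat n := Matrix.of fun a i => star (y (a, i)) with hK
  set T := Matrix.toLin (matBasis n) (matBasis n) A with hTdef
  have hVtr : ∀ l, μ l ≠ 0 → (V l).trace = 0 := by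
    intro l hl
    have h1 : (μ l : ℂ) * (star (entangled n) ⬝ᵥ (u l).ofLp) = 0 := by
      have h2 : star (entangled n) ⬝ᵥ (M *ᵥ (u l).ofLp) = 0 := by
        have h3 := congrArg star hMe
        rw [star_mulVec, hM.1.eq, star_zero] at h3
        rw [dotProduct_mulVec, h3, zero_dotProduct]
      rw [hM.1.mulVec_eigenvectorBasis l, dotProduct_smul, Complex.real_smul] at h2
      exact h2
    have h2 := (mul_eq_zero.mp h1).resolve_left (by exact_mod_cast hl)
    have h3 : (V l).trace = star (star (entangled n) ⬝ᵥ (u l).ofLp) := by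
      simp [Matrix.trace, hV, dotProduct, entangled, Fintype.sum_prod_type]
    rw [h3, h2, star_zero]
  have hVV : ∀ l l', (V l * (V l')ᴴ).trace = if l = l' then 1 else 0 := by
    intro l l'
    rw [← orthonormal_iff_ite.mp u.orthonormal l l', EuclideanSpace.inner_eq_star_dotProduct]
    simp [Matrix.trace, Matrix.mul_apply, hV, dotProduct, Fintype.sum_prod_type, mul_comm]
  let σ := (Fintype.equivFin {l // μ l ≠ 0}).symm
  have hsum : ∀ F : Fin n × Fin n → Mat n,
      ∑ l, (μ l : ℂ) • F l = ∑ j, (μ (σ j) : ℂ) • F (σ j) := by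
    intro F
    rw [Equiv.sum_comp σ (fun l : {l // μ l ≠ 0} => (μ l : ℂ) • F l)]
    rw [← Finset.sum_subtype (Finset.univ.filter fun l => μ l ≠ 0) (by simp)
      (fun l => (μ l : ℂ) • F l)]
    refine (Finset.sum_filter_of_ne (p := fun l => μ l ≠ 0) fun l _ hl h0 => hl ?_).symm
    rw [h0, Complex.ofReal_zero, zero_smul]
  have hKK : (∑ l, (μ l : ℂ) • ((V l)ᴴ * V l)) + (K + Kᴴ) = 0 := by
    simpa only [hone, mul_one, one_mul] using (hT 1).symm
  refine ⟨-T, _, fun j => V (σ j), fun j => μ (σ j), (Complex.I / 2) • (Kᴴ - K), ?_, ?_, ?_, ?_,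
    ?_, ?_⟩
  · intro t ht
    have h1 : LinearMap.toMatrix (matBasis n) (matBasis n) (-((t : ℂ) • -T)) = t • A := by
      rw [smul_neg, neg_neg, hTdef, map_smul, LinearMap.toMatrix_toLin]
      rfl
    rw [expEnd, h1, ← hA t ht, Matrix.toLin_toMatrix]
  · intro j
    rw [ntrace, hVtr _ (σ j).2, mul_zero]
  · intro j k
    simp [ntrace, hVV, Subtype.val_inj]
  · exact fun j => hM.eigenvalues_nonneg _
  · rw [conjTranspose_smul, conjTranspose_sub, conjTranspose_conjTranspose, ← neg_sub K Kᴴ,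
      smul_neg, ← neg_smul]
    congr 1
    simp [neg_div]
  · intro x
    have hKK' : (∑ l, (μ l : ℂ) • ((V l)ᴴ * V l)) = -(K + Kᴴ) := eq_neg_of_add_eq_zero_left hKK
    rw [LinearMap.neg_apply, hT x, Finset.sum_sub_distrib,
      ← hsum fun l => (V l)ᴴ * x * V l]
    have h1 : ∑ j, ((μ (σ j) : ℂ) / 2) •
        ((V (σ j))ᴴ * V (σ j) * x + x * ((V (σ j))ᴴ * V (σ j))) =
        (1 / 2 : ℂ) • (-(K + Kᴴ) * x + x * -(K + Kᴴ)) := by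
      rw [← hKK', hsum fun l => (V l)ᴴ * V l, Finset.sum_mul, Finset.mul_sum,
        ← Finset.sum_add_distrib, Finset.smul_sum]
      refine Finset.sum_congr rfl fun j _ => ?_
      rw [smul_mul_assoc, mul_smul_comm, ← smul_add, smul_smul]
      congr 1
      ring
    have h2 : Complex.I • ((Complex.I / 2) • (Kᴴ - K) * x - x * (Complex.I / 2) • (Kᴴ - K)) =
        (-1 / 2 : ℂ) • ((Kᴴ - K) * x - x * (Kᴴ - K)) := by
      rw [smul_mul_assoc, mul_smul_comm, ← smul_sub, smul_smul, mul_div_assoc', Complex.I_mul_I]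
    rw [h1, h2]
    simp only [neg_mul, mul_neg, add_mul, mul_add, sub_mul, mul_sub]
    module
end
end

section
/- Let v_1, …, v_m ∈ M_n(ℂ), let ω_1, …, ω_m be nonnegative real numbers, and let w ∈ M_n(ℂ) be hermitian. Define the linear map L on M_n(ℂ) by L(x) = Σ_{j=1}^m ( (ω_j/2)(v_j* v_j x + x v_j* v_j) − ω_j v_j* x v_j ) + i(w x − x w). Then for every t ≥ 0, the map exp(−tL) is a quantum channel on M_n(ℂ), i.e. it is unital and completely positive; in particular (exp(−tL))_{t≥0} is a quantum Markov semigroup on M_n(ℂ). -/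
open Matrix
open scoped ComplexOrder

noncomputable section

open Filter Topology in
lemma Matrix.PosSemidef.of_tendsto {ι κ : Type*} [Fintype κ] {l : Filter ι} [l.NeBot]
    {F : ι → Matrix κ κ ℂ} {M : Matrix κ κ ℂ} (hF : ∀ᶠ i in l, (F i).PosSemidef)
    (h : Tendsto F l (𝓝 M)) : M.PosSemidef := by
  refine .of_dotProduct_mulVec_nonneg ?_ fun x => ?_
  · have hc : Tendsto (fun i => (F i)ᴴ) l (𝓝 Mᴴ) :=
      (Continuous.matrix_conjTranspose continuous_id).continuousAt.tendsto.comp h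
    exact tendsto_nhds_unique (hc.congr' (hF.mono fun i hi => hi.1)) h
  · have hc : Continuous fun A : Matrix κ κ ℂ => star x ⬝ᵥ (A *ᵥ x) := by fun_prop
    exact ge_of_tendsto (hc.continuousAt.tendsto.comp h)
      (hF.mono fun i hi => hi.dotProduct_mulVec_nonneg x)

namespace IsCompletelyPositive

variable {n : ℕ} {Φ Ψ : Mat n →ₗ[ℂ] Mat n}

lemma id : IsCompletelyPositive n LinearMap.id := fun _ _ _ hX => hX

lemma zero : IsCompletelyPositive n 0 := fun _ _ _ _ => Matrix.PosSemidef.zero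

lemma comp (hΦ : IsCompletelyPositive n Φ) (hΨ : IsCompletelyPositive n Ψ) :
    IsCompletelyPositive n (Φ.comp Ψ) :=
  fun k hk X hX => hΦ k hk _ (hΨ k hk X hX)

lemma add (hΦ : IsCompletelyPositive n Φ) (hΨ : IsCompletelyPositive n Ψ) :
    IsCompletelyPositive n (Φ + Ψ) :=
  fun k hk X hX => (hΦ k hk X hX).add (hΨ k hk X hX)

lemma sum {ι : Type*} (s : Finset ι) {F : ι → Mat n →ₗ[ℂ] Mat n}
    (hF : ∀ i ∈ s, IsCompletelyPositive n (F i)) : IsCompletelyPositive n (∑ i ∈ s, F i) :=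
  Finset.sum_induction F (IsCompletelyPositive n) (fun _ _ => add) zero hF

lemma smul {c : ℂ} (hc : 0 ≤ c) (hΦ : IsCompletelyPositive n Φ) :
    IsCompletelyPositive n (c • Φ) :=
  fun k hk X hX => (hΦ k hk X hX).smul hc

lemma pow (hΦ : IsCompletelyPositive n Φ) (k : ℕ) : IsCompletelyPositive n (Φ ^ k) := by
  induction k with
  | zero => exact id
  | succ k ih => exact ih.comp hΦ

open Filter Topology in
lemma of_tendsto {ι : Type*} {l : Filter ι} [l.NeBot] {F : ι → Mat n →ₗ[ℂ] Mat n}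
    (hF : ∀ᶠ i in l, IsCompletelyPositive n (F i))
    (h : ∀ x, Tendsto (fun i => F i x) l (𝓝 (Φ x))) : IsCompletelyPositive n Φ := by
  intro k hk X hX
  refine Matrix.PosSemidef.of_tendsto (hF.mono fun i hi => hi k hk X hX) ?_
  refine tendsto_pi_nhds.2 fun p => tendsto_pi_nhds.2 fun q => ?_
  exact tendsto_pi_nhds.1 (tendsto_pi_nhds.1 (h _) p.2) q.2

end IsCompletelyPositive

/-- The conjugation `x ↦ bᴴ * x * b`. -/
def conjMap {n : ℕ} (b : Mat n) : Mat n →ₗ[ℂ] Mat n :=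
  LinearMap.mulLeftRight ℂ (bᴴ, b)

lemma conjMap_apply {n : ℕ} (b x : Mat n) : conjMap b x = bᴴ * x * b := by
  simp [conjMap]

open scoped Kronecker in
lemma isCompletelyPositive_conjMap {n : ℕ} (b : Mat n) :
    IsCompletelyPositive n (conjMap b) := by
  intro k _ X hX
  convert hX.conjTranspose_mul_mul_same ((1 : Matrix (Fin k) (Fin k) ℂ) ⊗ₖ b) using 1
  ext p q
  simp [blockMap, conjMap_apply, Matrix.mul_apply, Fintype.sum_prod_type, Matrix.one_apply,
    apply_ite, ite_mul]

section Exponential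

variable {n : ℕ}

section Continuity

attribute [local instance] Matrix.linftyOpNormedRing Matrix.linftyOpNormedAlgebra

lemma continuous_toLin_apply (x : Mat n) :
    Continuous fun M => Matrix.toLin (matBasis n) (matBasis n) M x :=
  LinearMap.continuous_of_finiteDimensional
    ((LinearMap.applyₗ x).comp (Matrix.toLin (matBasis n) (matBasis n)).toLinearMap)

lemma expEnd_hasSum (Φ : Mat n →ₗ[ℂ] Mat n) (x : Mat n) :
    HasSum (fun k : ℕ => ((k.factorial : ℂ)⁻¹) • (Φ ^ k) x) (expEnd n Φ x) := by
  have h := (NormedSpace.exp_series_hasSum_exp' (𝕂 := ℂ)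
    (LinearMap.toMatrix (matBasis n) (matBasis n) Φ)).map
    ((LinearMap.applyₗ x).comp (Matrix.toLin (matBasis n) (matBasis n)).toLinearMap)
    (continuous_toLin_apply x)
  refine HasSum.congr_fun h fun k => ?_
  simp [LinearMap.toMatrix_pow]

lemma continuous_expEnd_apply {T : Type*} [TopologicalSpace T] (F : T → Mat n →ₗ[ℂ] Mat n)
    (hF : Continuous fun t => LinearMap.toMatrix (matBasis n) (matBasis n) (F t)) (x : Mat n) :
    Continuous fun t => expEnd n (F t) x :=
  (continuous_toLin_apply x).comp (NormedSpace.exp_continuous.comp hF)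

end Continuity

lemma expEnd_zero : expEnd n 0 = LinearMap.id := by
  simp [expEnd]

lemma expEnd_add_of_commute {Φ Ψ : Mat n →ₗ[ℂ] Mat n} (h : Commute Φ Ψ) :
    expEnd n (Φ + Ψ) = (expEnd n Φ).comp (expEnd n Ψ) := by
  have hc : Commute (LinearMap.toMatrix (matBasis n) (matBasis n) Φ)
      (LinearMap.toMatrix (matBasis n) (matBasis n) Ψ) := by
    rw [Commute, SemiconjBy, ← LinearMap.toMatrix_mul, ← LinearMap.toMatrix_mul, h.eq]
  rw [expEnd, map_add, Matrix.exp_add_of_commute _ _ hc, Matrix.toLin_mul _ (matBasis n)]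
  rfl

lemma commute_smul_id (Φ : Mat n →ₗ[ℂ] Mat n) (c : ℂ) : Commute Φ (c • LinearMap.id) :=
  Commute.smul_right (Commute.one_right Φ) c

lemma expEnd_apply_of_apply_eq_smul {Φ : Mat n →ₗ[ℂ] Mat n} {x : Mat n} {c : ℂ}
    (h : Φ x = c • x) : expEnd n Φ x = Complex.exp c • x := by
  have hp (k : ℕ) : (Φ ^ k) x = c ^ k • x := by
    induction k with
    | zero => simp
    | succ k ih => rw [pow_succ', Module.End.mul_apply, ih, map_smul, h, smul_smul, pow_succ]
  have he := (NormedSpace.exp_series_hasSum_exp' (𝕂 := ℂ) c).smul_const x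
  rw [← Complex.exp_eq_exp_ℂ] at he
  refine (expEnd_hasSum Φ x).unique ?_
  simpa [hp, smul_smul] using he

lemma IsCompletelyPositive.expEnd {Φ : Mat n →ₗ[ℂ] Mat n} (hΦ : IsCompletelyPositive n Φ) :
    IsCompletelyPositive n (expEnd n Φ) := by
  refine .of_tendsto (l := Filter.atTop)
    (F := fun N => ∑ k ∈ Finset.range N, ((k.factorial : ℂ)⁻¹) • Φ ^ k)
    (.of_forall fun N => .sum _ fun k _ => .smul (by positivity) (hΦ.pow k)) fun x => ?_
  simpa using (expEnd_hasSum Φ x).tendsto_sum_nat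

lemma isCompletelyPositive_expEnd_real_smul_id (r : ℝ) :
    IsCompletelyPositive n (expEnd n ((r : ℂ) • LinearMap.id)) := by
  have h : expEnd n ((r : ℂ) • LinearMap.id) = ((Real.exp r : ℝ) : ℂ) • LinearMap.id := by
    ext1 x
    rw [Complex.ofReal_exp]
    exact expEnd_apply_of_apply_eq_smul rfl
  rw [h]
  exact .smul (by exact_mod_cast (Real.exp_pos r).le) .id

/-- The map `x ↦ aᴴ * x + x * a`. -/
def lyapunovMap (a : Mat n) : Mat n →ₗ[ℂ] Mat n :=
  LinearMap.mulLeft ℂ aᴴ + LinearMap.mulRight ℂ a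

lemma lyapunovMap_apply (a x : Mat n) : lyapunovMap a x = aᴴ * x + x * a := rfl

/-- Completing the square in `x ↦ aᴴ * x + x * a`. -/
lemma lyapunovMap_add_smul_conjMap (a : Mat n) {s : ℝ} (hs : s ≠ 0) :
    lyapunovMap a + (s : ℂ) • conjMap a =
      (s : ℂ) • conjMap (a + ((s⁻¹ : ℝ) : ℂ) • (1 : Mat n)) +
        ((-s⁻¹ : ℝ) : ℂ) • LinearMap.id := by
  have hs' : (s : ℂ) ≠ 0 := by exact_mod_cast hs
  ext1 x
  simp only [LinearMap.add_apply, LinearMap.smul_apply, lyapunovMap_apply, conjMap_apply,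
    LinearMap.id_apply, conjTranspose_add, conjTranspose_smul, conjTranspose_one, add_mul,
    mul_add, Matrix.smul_mul, Matrix.mul_smul, one_mul, mul_one, Complex.star_def,
    Complex.conj_ofReal, smul_add, smul_smul]
  push_cast
  rw [mul_inv_cancel₀ hs', mul_inv_cancel_left₀ hs']
  module

open Filter Topology in
lemma isCompletelyPositive_expEnd_add_lyapunovMap {Ψ : Mat n →ₗ[ℂ] Mat n}
    (hΨ : IsCompletelyPositive n Ψ) (a : Mat n) :
    IsCompletelyPositive n (expEnd n (Ψ + lyapunovMap a)) := by
  have hpos : ∀ s : ℝ, 0 < s →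
      IsCompletelyPositive n (expEnd n (Ψ + lyapunovMap a + (s : ℂ) • conjMap a)) := by
    intro s hs
    rw [add_assoc, lyapunovMap_add_smul_conjMap a hs.ne', ← add_assoc,
      expEnd_add_of_commute (commute_smul_id _ _)]
    refine (hΨ.add (.smul ?_ (isCompletelyPositive_conjMap _))).expEnd.comp
      (isCompletelyPositive_expEnd_real_smul_id _)
    exact_mod_cast hs.le
  refine .of_tendsto (l := 𝓝[>] (0 : ℝ)) (eventually_mem_nhdsWithin.mono hpos) fun x => ?_
  have hc := continuous_expEnd_apply
    (fun s : ℝ => Ψ + lyapunovMap a + (s : ℂ) • conjMap a)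
    (by simp only [map_add, map_smul]; fun_prop) x
  simpa using (hc.tendsto 0).mono_left nhdsWithin_le_nhds

end Exponential

/-- **A Lindblad generator generates a quantum Markov semigroup.**
If `L(x) = Σ_j ( (ω_j/2)(v_j* v_j x + x v_j* v_j) − ω_j v_j* x v_j ) + i (w x − x w)`
with `ω_j ≥ 0` and `w` hermitian, then `exp(−tL)` is a quantum channel for every `t ≥ 0`,
and `(exp(−tL))_{t ≥ 0}` is a quantum Markov semigroup. -/
theorem lindblad_generates_QMS {n m : ℕ} (v : Fin m → Mat n) (ω : Fin m → ℝ)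
    (hω : ∀ j, 0 ≤ ω j) (w : Mat n) (hw : wᴴ = w)
    (L : Mat n →ₗ[ℂ] Mat n)
    (hL : ∀ x : Mat n,
      L x = (∑ j, (((ω j : ℂ) / 2) • ((v j)ᴴ * v j * x + x * ((v j)ᴴ * v j))
                    - (ω j : ℂ) • ((v j)ᴴ * x * v j)))
            + Complex.I • (w * x - x * w)) :
    (∀ t : ℝ, 0 ≤ t → IsQuantumChannel n (expEnd n (-((t : ℂ) • L)))) ∧
    IsQMS n (fun t : ℝ => expEnd n (-((t : ℂ) • L))) := by
  have hch : ∀ t : ℝ, 0 ≤ t → IsQuantumChannel n (expEnd n (-((t : ℂ) • L))) := by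
    intro t ht
    refine ⟨?_, ?_⟩
    · set a : Mat n := (t : ℂ) • (Complex.I • w - ∑ j, ((ω j : ℂ) / 2) • ((v j)ᴴ * v j)) with ha
      have hdec : -((t : ℂ) • L) =
          (t : ℂ) • (∑ j, (ω j : ℂ) • conjMap (v j)) + lyapunovMap a := by
        have ha' : aᴴ =
            (t : ℂ) • (-(Complex.I • w) - ∑ j, ((ω j : ℂ) / 2) • ((v j)ᴴ * v j)) := by
          simp [ha, conjTranspose_sum, hw]
        ext1 x
        simp only [LinearMap.neg_apply, LinearMap.add_apply, LinearMap.smul_apply, hL,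
          LinearMap.sum_apply, conjMap_apply, lyapunovMap_apply, ha']
        simp only [ha, Matrix.smul_mul, Matrix.mul_smul, sub_mul, mul_sub, neg_mul,
          Finset.sum_mul, Finset.mul_sum, smul_add, Finset.sum_sub_distrib,
          Finset.sum_add_distrib, mul_assoc]
        module
      rw [hdec]
      refine isCompletelyPositive_expEnd_add_lyapunovMap (.smul (by exact_mod_cast ht) ?_) a
      exact .sum _ fun j _ =>
        .smul (by exact_mod_cast hω j) (isCompletelyPositive_conjMap (v j))
    · have hL1 : L 1 = 0 := by
        rw [hL]
        simp only [mul_one, one_mul, sub_self, smul_zero, add_zero]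
        refine Finset.sum_eq_zero fun j _ => ?_
        module
      simpa using expEnd_apply_of_apply_eq_smul (Φ := -((t : ℂ) • L)) (x := 1) (c := 0)
        (by simp [hL1])
  refine ⟨hch, hch, by simp [expEnd_zero], fun s t _ _ => ?_, fun x => ?_⟩
  · have hc : Commute (-((s : ℂ) • L)) (-((t : ℂ) • L)) :=
      (((Commute.refl L).smul_left _).smul_right _).neg_left.neg_right
    simp only
    rw [← expEnd_add_of_commute hc, Complex.ofReal_add, add_smul, neg_add]
  · refine continuous_expEnd_apply (fun t : ℝ => -((t : ℂ) • L)) ?_ x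
    simp only [map_neg, map_smul]
    fun_prop
end
end

section
/- Let L be a linear map on M_n(ℂ) with L(1) = 0 and L(x*) = L(x)* for all x. Then the following are equivalent: (1) for every t ≥ 0, the map exp(−tL) is completely positive and unital; (2) L is conditionally negative, i.e. for all m and all x_1, …, x_m, y_1, …, y_m ∈ M_n(ℂ) with Σ_{j=1}^m x_j y_j = 0, the matrix −Σ_{j,k=1}^m y_j* L(x_j* x_k) y_k is positive semidefinite. -/
open Matrix
open scoped ComplexOrder

noncomputable section

/-- `L` is conditionally negative: for all `x_1, …, x_m, y_1, …, y_m` with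
`Σ_j x_j y_j = 0`, the matrix `− Σ_{j,k} y_j* L(x_j* x_k) y_k` is positive semidefinite. -/
def CondNeg (n : ℕ) (L : Mat n →ₗ[ℂ] Mat n) : Prop :=
  ∀ (m : ℕ) (x y : Fin m → Mat n), (∑ j, x j * y j) = 0 →
    (-(∑ j, ∑ k, (y j)ᴴ * L ((x j)ᴴ * x k) * y k)).PosSemidef

theorem norm_pow_sub_pow_le_of_norm_le {A : Type*} [NormedRing A] [NormOneClass A] {a b : A} {c : ℝ}
    (ha : ‖a‖ ≤ c) (hb : ‖b‖ ≤ c) (hc : 1 ≤ c) (m : ℕ) :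
    ‖a ^ m - b ^ m‖ ≤ m * c ^ m * ‖a - b‖ := by
  have hc0 : 0 ≤ c := zero_le_one.trans hc
  induction m with
  | zero => simp
  | succ m ih =>
    have h : a ^ (m + 1) - b ^ (m + 1) = (a ^ m - b ^ m) * a + b ^ m * (a - b) := by
      rw [pow_succ, pow_succ]; noncomm_ring
    have hbm : ‖b ^ m‖ ≤ c ^ m := (norm_pow_le b m).trans (by gcongr)
    calc ‖a ^ (m + 1) - b ^ (m + 1)‖
        ≤ ‖a ^ m - b ^ m‖ * ‖a‖ + ‖b ^ m‖ * ‖a - b‖ := by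
          rw [h]
          exact (norm_add_le _ _).trans (add_le_add (norm_mul_le _ _) (norm_mul_le _ _))
      _ ≤ m * c ^ m * ‖a - b‖ * c + c ^ (m + 1) * ‖a - b‖ := by
          gcongr
          exact hbm.trans (pow_le_pow_right₀ hc m.le_succ)
      _ = ((m + 1 : ℕ) : ℝ) * c ^ (m + 1) * ‖a - b‖ := by push_cast; ring

theorem norm_exp_le_exp_norm {A : Type*} [NormedRing A] [NormOneClass A] [NormedAlgebra ℝ A]
    [CompleteSpace A] (x : A) : ‖NormedSpace.exp x‖ ≤ Real.exp ‖x‖ := by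
  have h1 := NormedSpace.exp_series_hasSum_exp' (𝕂 := ℝ) x
  have h2 := NormedSpace.exp_series_hasSum_exp' (𝕂 := ℝ) ‖x‖
  rw [← Real.exp_eq_exp_ℝ] at h2
  rw [← h1.tsum_eq]
  refine tsum_of_norm_bounded h2 fun m => ?_
  rw [norm_smul, smul_eq_mul, Real.norm_of_nonneg (by positivity)]
  gcongr
  exact norm_pow_le x m

open Filter Topology in
/-- Chernoff product formula for a second order perturbation of the identity. -/
theorem tendsto_one_add_smul_add_sq_smul_pow_exp {A : Type*} [NormedRing A] [NormOneClass A]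
    [NormedAlgebra ℝ A] [CompleteSpace A] (M C : A) {t : ℝ} (ht : 0 ≤ t) :
    Tendsto (fun m : ℕ => (1 + (t / m) • M + (t / m) ^ 2 • C) ^ m) atTop
      (𝓝 (NormedSpace.exp (t • M))) := by
  set R : ℝ := ‖M‖ + t * ‖C‖ with hR
  let g : ℝ → A := fun r =>
    (1 + (t * r) • M + (t * r) ^ 2 • C) - NormedSpace.exp ((t * r) • M)
  have hg : HasDerivAt g 0 0 := by
    have hs : HasDerivAt (fun r : ℝ => t * r) t 0 := by
      simpa using (hasDerivAt_id (0 : ℝ)).const_mul t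
    have he : HasDerivAt (fun r : ℝ => NormedSpace.exp ((t * r) • M)) (t • M) 0 := by
      have h0 : HasDerivAt (fun u : ℝ => NormedSpace.exp (u • M)) M (t * 0) := by
        simpa using hasDerivAt_exp_smul_const M (t * 0)
      exact h0.scomp (0 : ℝ) hs
    have hp : HasDerivAt (fun r : ℝ => 1 + (t * r) • M + (t * r) ^ 2 • C) (t • M) 0 := by
      simpa using ((hs.smul_const M).const_add 1).fun_add ((hs.fun_pow 2).smul_const C)
    simpa [g] using hp.fun_sub he
  have hm : Tendsto (fun m : ℕ => ((m : ℝ))⁻¹) atTop (𝓝[≠] 0) :=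
    tendsto_nhdsWithin_iff.2 ⟨tendsto_inv_atTop_nhds_zero_nat, by
      filter_upwards [eventually_gt_atTop 0] with m hm
      simpa using hm.ne'⟩
  have hlim : Tendsto (fun m : ℕ => Real.exp (t * R) * ‖(m : ℝ) • g ((m : ℝ)⁻¹)‖) atTop (𝓝 0) := by
    have h := (hg.tendsto_slope_zero.comp hm).norm.const_mul (Real.exp (t * R))
    simpa [g, Function.comp_def] using h
  rw [tendsto_iff_norm_sub_tendsto_zero]
  refine squeeze_zero' (Eventually.of_forall fun _ => norm_nonneg _) ?_ hlim
  filter_upwards [eventually_gt_atTop 0] with m hm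
  have hm0 : (0 : ℝ) < m := by exact_mod_cast hm
  have hm1 : (1 : ℝ) ≤ m := by exact_mod_cast hm
  set s : ℝ := t / m with hs
  have hs0 : 0 ≤ s := by positivity
  have hst : s ≤ t := div_le_self ht hm1
  have hR0 : 0 ≤ R := by positivity
  have hms : (m : ℝ) * s = t := by rw [hs]; field_simp
  have ha : ‖1 + s • M + s ^ 2 • C‖ ≤ Real.exp (s * R) :=
    calc ‖1 + s • M + s ^ 2 • C‖ ≤ ‖(1 : A)‖ + ‖s • M‖ + ‖s ^ 2 • C‖ := norm_add₃_le
      _ = 1 + s * ‖M‖ + s * s * ‖C‖ := by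
          rw [norm_one, norm_smul, norm_smul, Real.norm_of_nonneg hs0,
            Real.norm_of_nonneg (by positivity), sq]
      _ ≤ 1 + s * ‖M‖ + s * t * ‖C‖ := by gcongr
      _ = s * R + 1 := by rw [hR]; ring
      _ ≤ Real.exp (s * R) := Real.add_one_le_exp _
  have hb : ‖NormedSpace.exp (s • M)‖ ≤ Real.exp (s * R) := by
    refine (norm_exp_le_exp_norm _).trans (Real.exp_le_exp.2 ?_)
    rw [norm_smul, Real.norm_of_nonneg hs0]
    gcongr
    rw [hR]
    exact le_add_of_nonneg_right (by positivity)
  have hexp : NormedSpace.exp (t • M) = NormedSpace.exp (s • M) ^ m := by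
    let _ : NormedAlgebra ℚ A := NormedAlgebra.restrictScalars ℚ ℝ A
    rw [← NormedSpace.exp_nsmul, ← Nat.cast_smul_eq_nsmul ℝ, smul_smul, hms]
  rw [hexp]
  refine (norm_pow_sub_pow_le_of_norm_le ha hb (Real.one_le_exp (by positivity)) m).trans ?_
  rw [← Real.exp_nat_mul, ← mul_assoc, hms, norm_smul, Real.norm_of_nonneg hm0.le,
    mul_comm (m : ℝ), mul_assoc]
  simp [g, hs, div_eq_mul_inv]

theorem posSemidef_of_forall_nonneg {ι : Type*} [Fintype ι] {M : Matrix ι ι ℂ}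
    (h : ∀ w : ι → ℂ, 0 ≤ star w ⬝ᵥ (M *ᵥ w)) : M.PosSemidef := by
  classical
  rw [← Matrix.isPositive_toEuclideanLin_iff, LinearMap.isPositive_iff_complex]
  intro x
  have hx := h x.ofLp
  rw [Complex.nonneg_iff] at hx
  have : inner ℂ (Matrix.toEuclideanLin M x) x = star (star x.ofLp ⬝ᵥ (M *ᵥ x.ofLp)) := by
    rw [EuclideanSpace.inner_eq_star_dotProduct]
    rw [← Matrix.star_dotProduct_star, star_star, dotProduct_comm]
    rfl
  rw [this]
  constructor
  · apply Complex.ext <;> simp [← hx.2]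
  · simpa using hx.1

/-- The quadratic form of `blockMap n k Φ X` at `w`, as a linear functional of `Φ`. -/
def blockForm (n k : ℕ) (X : Matrix (Fin k × Fin n) (Fin k × Fin n) ℂ) (w : Fin k × Fin n → ℂ) :
    (Mat n →ₗ[ℂ] Mat n) →ₗ[ℂ] ℂ where
  toFun Φ := star w ⬝ᵥ (blockMap n k Φ X *ᵥ w)
  map_add' Φ Ψ := by
    rw [← dotProduct_add, ← Matrix.add_mulVec]
    rfl
  map_smul' c Φ := by
    rw [RingHom.id_apply, ← dotProduct_smul, ← Matrix.smul_mulVec]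
    rfl

theorem isCompletelyPositive_iff_blockForm_nonneg {n : ℕ} {Φ : Mat n →ₗ[ℂ] Mat n} :
    IsCompletelyPositive n Φ ↔ ∀ k : ℕ, 1 ≤ k → ∀ X : Matrix (Fin k × Fin n) (Fin k × Fin n) ℂ,
      X.PosSemidef → ∀ w, 0 ≤ blockForm n k X w Φ :=
  ⟨fun h k hk X hX w => (h k hk X hX).dotProduct_mulVec_nonneg w,
    fun h k hk X hX => posSemidef_of_forall_nonneg (h k hk X hX)⟩

theorem blockForm_apply {n k : ℕ} (X : Matrix (Fin k × Fin n) (Fin k × Fin n) ℂ)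
    (w : Fin k × Fin n → ℂ) (Φ : Mat n →ₗ[ℂ] Mat n) :
    blockForm n k X w Φ = ∑ j, ∑ l, star (fun i => w (j, i)) ⬝ᵥ
      (Φ (Matrix.of fun i i' => X (j, i) (l, i')) *ᵥ fun i => w (l, i)) := by
  simp only [blockForm, LinearMap.coe_mk, AddHom.coe_mk, dotProduct, Matrix.mulVec, blockMap,
    Fintype.sum_prod_type, Matrix.of_apply, Pi.star_apply, Finset.mul_sum]
  refine Finset.sum_congr rfl fun j _ => ?_
  exact Finset.sum_comm

/-- To test complete positivity it is enough to consider rank one block matrices. -/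
theorem isCompletelyPositive_of_vecMulVec {n : ℕ} {Φ : Mat n →ₗ[ℂ] Mat n}
    (h : ∀ (k : ℕ) (v u : Fin k → Fin n → ℂ),
      0 ≤ ∑ j, ∑ l, star (u j) ⬝ᵥ (Φ (vecMulVec (v j) (star (v l))) *ᵥ u l)) :
    IsCompletelyPositive n Φ := by
  rw [isCompletelyPositive_iff_blockForm_nonneg]
  intro k _ X hX w
  obtain ⟨r, v, rfl⟩ := Matrix.posSemidef_iff_eq_sum_vecMulVec.1 hX
  have key : blockForm n k (∑ i, vecMulVec (v i) (star (v i))) w Φ =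
      ∑ i, blockForm n k (vecMulVec (v i) (star (v i))) w Φ := by
    simp only [blockForm_apply]
    rw [Finset.sum_comm]
    simp_rw [Finset.sum_comm (s := (Finset.univ : Finset (Fin r)))]
    rw [Finset.sum_comm]
    refine Finset.sum_congr rfl fun j _ => Finset.sum_congr rfl fun l _ => ?_
    rw [← dotProduct_sum, ← Matrix.sum_mulVec, ← map_sum]
    congr 3
    ext i i'
    simp [Matrix.sum_apply]
  rw [key]
  refine Finset.sum_nonneg fun i _ => ?_
  rw [blockForm_apply]
  exact h k (fun j a => v i (j, a)) (fun j a => w (j, a))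

theorem blockMap_comp {n k : ℕ} (Φ Ψ : Mat n →ₗ[ℂ] Mat n)
    (X : Matrix (Fin k × Fin n) (Fin k × Fin n) ℂ) :
    blockMap n k (Φ * Ψ) X = blockMap n k Φ (blockMap n k Ψ X) := rfl

theorem IsCompletelyPositive.pow_s2 {n : ℕ} {Φ : Mat n →ₗ[ℂ] Mat n}
    (h : IsCompletelyPositive n Φ) (m : ℕ) : IsCompletelyPositive n (Φ ^ m) := by
  induction m with
  | zero => exact fun k _ X hX => hX
  | succ m ih =>
    intro k hk X hX
    rw [pow_succ, blockMap_comp]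
    exact ih k hk _ (h k hk X hX)

/-- Linear maps on `Mat n` as continuous linear operators on a Euclidean space. -/
def endEquivCLM (n : ℕ) : (Mat n →ₗ[ℂ] Mat n) ≃ₐ[ℂ]
    (EuclideanSpace ℂ (Fin n × Fin n) →L[ℂ] EuclideanSpace ℂ (Fin n × Fin n)) :=
  (LinearMap.toMatrixAlgEquiv (matBasis n)).trans
    (Matrix.toEuclideanCLM (n := Fin n × Fin n) (𝕜 := ℂ)).toAlgEquiv

theorem endEquivCLM_expEnd {n : ℕ} (L : Mat n →ₗ[ℂ] Mat n) :
    endEquivCLM n (expEnd n L) = NormedSpace.exp (endEquivCLM n L) := by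
  let e : Matrix (Fin n × Fin n) (Fin n × Fin n) ℂ ≃L[ℂ]
      (EuclideanSpace ℂ (Fin n × Fin n) →L[ℂ] EuclideanSpace ℂ (Fin n × Fin n)) :=
    LinearEquiv.toContinuousLinearEquiv
      (Matrix.toEuclideanCLM (n := Fin n × Fin n) (𝕜 := ℂ)).toAlgEquiv.toLinearEquiv
  have he : ∀ A, e A = Matrix.toEuclideanCLM (n := Fin n × Fin n) (𝕜 := ℂ) A := fun _ => rfl
  have hexp : ∀ A, e (NormedSpace.exp A) = NormedSpace.exp (e A) := fun A => by
    rw [NormedSpace.exp_eq_tsum ℂ, NormedSpace.exp_eq_tsum ℂ, e.map_tsum]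
    refine tsum_congr fun m => ?_
    rw [map_smul, he, he, map_pow]
  have hmat : LinearMap.toMatrixAlgEquiv (matBasis n) (expEnd n L) =
      NormedSpace.exp (LinearMap.toMatrix (matBasis n) (matBasis n) L) :=
    LinearMap.toMatrix_toLin _ _ _
  change e (LinearMap.toMatrixAlgEquiv (matBasis n) (expEnd n L)) = _
  rw [hmat, hexp]
  rfl

open Filter Topology in
/-- The Euler scheme for `exp (t M)` with a second order perturbation, tested against a linear
map. -/
theorem tendsto_apply_pow_expEnd {n : ℕ} [NeZero n] {V : Type*} [NormedAddCommGroup V]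
    [NormedSpace ℂ V] (ℓ : (Mat n →ₗ[ℂ] Mat n) →ₗ[ℂ] V) (M C : Mat n →ₗ[ℂ] Mat n)
    {t : ℝ} (ht : 0 ≤ t) :
    Tendsto (fun m : ℕ =>
        ℓ ((1 + ((t / m : ℝ) : ℂ) • M + (((t / m) ^ 2 : ℝ) : ℂ) • C) ^ m)) atTop
      (𝓝 (ℓ (expEnd n ((t : ℂ) • M)))) := by
  let θ := endEquivCLM n
  have hℓ : Continuous (ℓ ∘ₗ θ.symm.toLinearMap) := LinearMap.continuous_of_finiteDimensional _
  have h := (hℓ.tendsto _).comp (tendsto_one_add_smul_add_sq_smul_pow_exp (θ M) (θ C) ht)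
  have hexp : NormedSpace.exp (t • θ M) = θ (expEnd n ((t : ℂ) • M)) := by
    rw [endEquivCLM_expEnd, map_smul]
    rfl
  rw [hexp] at h
  have hx : (ℓ ∘ₗ θ.symm.toLinearMap) (θ (expEnd n ((t : ℂ) • M))) = ℓ (expEnd n ((t : ℂ) • M)) := by
    simp
  rw [hx] at h
  refine h.congr fun m => ?_
  simp only [Function.comp_apply, LinearMap.comp_apply, AlgEquiv.toLinearMap_apply]
  congr 1
  rw [AlgEquiv.symm_apply_eq]
  simp only [map_pow, map_add, map_one, map_smul]
  rfl

theorem hasDerivAt_apply_expEnd {n : ℕ} (ℓ : (Mat n →ₗ[ℂ] Mat n) →ₗ[ℂ] ℂ)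
    (M : Mat n →ₗ[ℂ] Mat n) :
    HasDerivAt (fun t : ℝ => ℓ (expEnd n ((t : ℂ) • M))) (ℓ M) 0 := by
  let θ := endEquivCLM n
  let ψ : (EuclideanSpace ℂ (Fin n × Fin n) →L[ℂ] EuclideanSpace ℂ (Fin n × Fin n)) →L[ℝ] ℂ :=
    (LinearMap.toContinuousLinearMap (ℓ ∘ₗ θ.symm.toLinearMap)).restrictScalars ℝ
  have hψ : ∀ Φ, ψ (θ Φ) = ℓ Φ := fun Φ => by simp [ψ]
  have h := ψ.hasFDerivAt.comp_hasDerivAt (0 : ℝ) (hasDerivAt_exp_smul_const (θ M) (0 : ℝ))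
  rw [zero_smul, NormedSpace.exp_zero, one_mul, hψ] at h
  refine h.congr_of_eventuallyEq (Filter.Eventually.of_forall fun t => ?_)
  change ℓ (expEnd n ((t : ℂ) • M)) = _
  rw [← hψ, endEquivCLM_expEnd, map_smul]
  rfl

theorem expEnd_apply_of_apply_eq_zero {n : ℕ} {M : Mat n →ₗ[ℂ] Mat n} {x : Mat n} (hx : M x = 0)
    {t : ℝ} (ht : 0 ≤ t) : expEnd n ((t : ℂ) • M) x = x := by
  ext i j
  have : NeZero n := ⟨by rintro rfl; exact i.elim0⟩
  let ℓ : (Mat n →ₗ[ℂ] Mat n) →ₗ[ℂ] ℂ :=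
    { toFun := fun Φ => Φ x i j, map_add' := fun _ _ => rfl, map_smul' := fun _ _ => rfl }
  have hpow : ∀ (s : ℂ) (m : ℕ), ((1 + s • M) ^ m) x = x := fun s m => by
    induction m with
    | zero => rfl
    | succ m ih => simp [pow_succ, hx, ih]
  have h := tendsto_apply_pow_expEnd ℓ M 0 ht
  simp only [smul_zero, add_zero] at h
  have hconst : ∀ m : ℕ, ℓ ((1 + ((t / m : ℝ) : ℂ) • M) ^ m) = x i j := fun m =>
    congrFun (congrFun (hpow _ m) i) j
  simp only [hconst] at h
  exact tendsto_nhds_unique h tendsto_const_nhds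

theorem conjTranspose_vecMulVec_mul_mul_apply {n : ℕ} (A : Mat n) (u v : Fin n → ℂ) (i : Fin n) :
    ((vecMulVec u (Pi.single i 1))ᴴ * A * vecMulVec v (Pi.single i 1)) i i =
      star u ⬝ᵥ (A *ᵥ v) := by
  rw [conjTranspose_vecMulVec, Matrix.vecMulVec_mul, Matrix.vecMulVec_mul_vecMulVec,
    Matrix.dotProduct_mulVec]
  simp [vecMulVec_apply]

/-- The matrix `G` with `G v = -L(v e*) e`, where `e` is the `i`-th standard basis vector. -/
def driftMatrix {n : ℕ} (L : Mat n →ₗ[ℂ] Mat n) (i : Fin n) : Mat n :=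
  LinearMap.toMatrix' ((Matrix.mulVecBilin ℂ ℂ).flip (Pi.single i 1) ∘ₗ (-L) ∘ₗ
    (vecMulVecBilin ℂ ℂ).flip (Pi.single i 1))

theorem driftMatrix_mulVec {n : ℕ} (L : Mat n →ₗ[ℂ] Mat n) (i : Fin n) (v : Fin n → ℂ) :
    driftMatrix L i *ᵥ v = -(L (vecMulVec v (Pi.single i 1)) *ᵥ Pi.single i 1) := by
  rw [driftMatrix, LinearMap.toMatrix'_mulVec]
  simp

theorem CondNeg.quadratic_le {n : ℕ} {L : Mat n →ₗ[ℂ] Mat n} (hL : CondNeg n L)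
    (hL1 : L 1 = 0) (hLstar : ∀ x : Mat n, L xᴴ = (L x)ᴴ) (i : Fin n)
    {k : ℕ} (v u : Fin k → Fin n → ℂ) :
    0 ≤ -(∑ j, ∑ l, star (u j) ⬝ᵥ (L (vecMulVec (v j) (star (v l))) *ᵥ u l))
      - (∑ l, star (v l) ⬝ᵥ u l) * (∑ j, star (u j) ⬝ᵥ (driftMatrix L i *ᵥ v j))
      - star (∑ l, star (v l) ⬝ᵥ u l) *
        star (∑ j, star (u j) ⬝ᵥ (driftMatrix L i *ᵥ v j)) := by
  set e : Fin n → ℂ := Pi.single i 1 with he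
  have hee : e ⬝ᵥ e = 1 := by simp [he]
  have hes : star e = e := by simp [he]
  set s : ℂ := ∑ l, star (v l) ⬝ᵥ u l with hs
  have hsum : ∑ j, (Fin.cons (-s • (1 : Mat n)) (fun j => vecMulVec e (star (v j))) :
      Fin (k + 1) → Mat n) j *
      (Fin.cons (vecMulVec e e) (fun j => vecMulVec (u j) e) : Fin (k + 1) → Mat n) j = 0 := by
    simp only [Fin.sum_univ_succ, Fin.cons_zero, Fin.cons_succ, Matrix.vecMulVec_mul_vecMulVec]
    simp [Matrix.vecMulVec_smul, ← Finset.sum_smul, hs]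
  have h := (hL (k + 1) _ _ hsum).diag_nonneg (i := i)
  have h1 : ∀ j, star (u j) ⬝ᵥ (L (vecMulVec (v j) e) *ᵥ e) =
      -(star (u j) ⬝ᵥ (driftMatrix L i *ᵥ v j)) := fun j => by
    rw [driftMatrix_mulVec, dotProduct_neg, neg_neg]
  have h2 : ∀ j, star e ⬝ᵥ (L (vecMulVec e (star (v j))) *ᵥ u j) =
      -star (star (u j) ⬝ᵥ (driftMatrix L i *ᵥ v j)) := fun j => by
    rw [driftMatrix_mulVec, dotProduct_neg, star_neg, neg_neg, ← he]
    have hc : vecMulVec e (star (v j)) = (vecMulVec (v j) e)ᴴ := by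
      rw [conjTranspose_vecMulVec, hes]
    rw [hc, hLstar, ← Matrix.star_dotProduct_star, star_star, Matrix.star_mulVec,
      ← Matrix.dotProduct_mulVec, dotProduct_comm]
  simp only [Fin.sum_univ_succ, Fin.cons_zero, Fin.cons_succ, Matrix.neg_apply, Matrix.add_apply,
    Matrix.sum_apply, he, conjTranspose_vecMulVec_mul_mul_apply] at h
  simp only [← he] at h
  have e1 : L ((-s • (1 : Mat n))ᴴ * -s • (1 : Mat n)) = 0 := by simp [hL1]
  have e2 : ∀ w, L ((-s • (1 : Mat n))ᴴ * vecMulVec e (star (v w))) =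
      -star s • L (vecMulVec e (star (v w))) := fun w => by simp
  have e3 : ∀ w, L ((vecMulVec e (star (v w)))ᴴ * -s • (1 : Mat n)) =
      -s • L (vecMulVec (v w) e) := fun w => by
    simp [conjTranspose_vecMulVec, hes]
  have e4 : ∀ w w', (vecMulVec e (star (v w)))ᴴ * vecMulVec e (star (v w')) =
      vecMulVec (v w) (star (v w')) := fun w w' => by
    rw [conjTranspose_vecMulVec, hes, star_star, Matrix.vecMulVec_mul_vecMulVec, hee, one_smul]
  simp only [e1, e2, e3, e4, Matrix.zero_mulVec, dotProduct_zero, Matrix.smul_mulVec,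
    dotProduct_smul, h1, h2, Finset.sum_add_distrib, smul_eq_mul, neg_mul_neg,
    ← Finset.mul_sum, ← star_sum] at h
  convert! h using 1
  ring

/-- One Euler step for the semigroup generated by `-L`, corrected to second order by
`x ↦ G x Gᴴ`, is completely positive. -/
theorem CondNeg.isCompletelyPositive_euler {n : ℕ} {L : Mat n →ₗ[ℂ] Mat n} (hL : CondNeg n L)
    (hL1 : L 1 = 0) (hLstar : ∀ x : Mat n, L xᴴ = (L x)ᴴ) (i : Fin n) {s : ℝ} (hs : 0 ≤ s) :
    IsCompletelyPositive n (1 + (s : ℂ) • (-L) + ((s ^ 2 : ℝ) : ℂ) •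
      (LinearMap.mulLeft ℂ (driftMatrix L i) * LinearMap.mulRight ℂ (driftMatrix L i)ᴴ)) := by
  refine isCompletelyPositive_of_vecMulVec fun k v u => ?_
  set G := driftMatrix L i
  have h := hL.quadratic_le hL1 hLstar i v u
  set p := ∑ l, star (v l) ⬝ᵥ u l with hp
  set a := ∑ j, star (u j) ⬝ᵥ (G *ᵥ v j) with ha
  set q := ∑ j, ∑ l, star (u j) ⬝ᵥ (L (vecMulVec (v j) (star (v l))) *ᵥ u l) with hq
  have hpp : ∑ j, ∑ l, star (u j) ⬝ᵥ (vecMulVec (v j) (star (v l)) *ᵥ u l) = star p * p := by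
    have : star p = ∑ j, star (u j) ⬝ᵥ v j := by
      rw [hp, star_sum]
      refine Finset.sum_congr rfl fun j _ => ?_
      rw [Matrix.star_dotProduct, star_star]
    rw [this, hp, Finset.sum_mul_sum]
    simp [Matrix.vecMulVec_mulVec, mul_comm]
  have haa : ∑ j, ∑ l, star (u j) ⬝ᵥ ((G * (vecMulVec (v j) (star (v l)) * Gᴴ)) *ᵥ u l) =
      a * star a := by
    have : star a = ∑ j, star (G *ᵥ v j) ⬝ᵥ u j := by
      rw [ha, star_sum]
      refine Finset.sum_congr rfl fun j _ => ?_
      rw [Matrix.star_dotProduct, star_star]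
    rw [this, ha, Finset.sum_mul_sum]
    simp [Matrix.mul_vecMulVec, Matrix.vecMulVec_mul, Matrix.vecMulVec_mulVec,
      Matrix.star_mulVec, mul_comm]
  have key : ∑ j, ∑ l, star (u j) ⬝ᵥ ((1 + (s : ℂ) • (-L) + ((s ^ 2 : ℝ) : ℂ) •
      (LinearMap.mulLeft ℂ G * LinearMap.mulRight ℂ Gᴴ) : Mat n →ₗ[ℂ] Mat n)
        (vecMulVec (v j) (star (v l))) *ᵥ u l) =
      star (p + s * star a) * (p + s * star a) + s * (-q - p * a - star p * star a) := by
    have hexp : star (p + s * star a) * (p + s * star a) + s * (-q - p * a - star p * star a) =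
        star p * p + s * (-q) + (s ^ 2 : ℝ) * (a * star a) := by
      simp
      ring
    rw [hexp, ← hpp, ← haa, hq]
    simp [Matrix.add_mulVec, Matrix.neg_mulVec, Matrix.smul_mulVec, Finset.sum_add_distrib,
      Finset.mul_sum]
  rw [key]
  exact add_nonneg (star_mul_self_nonneg _) (mul_nonneg (by exact_mod_cast hs) h)

theorem CondNeg.isCompletelyPositive_expEnd {n : ℕ} {L : Mat n →ₗ[ℂ] Mat n} (hL : CondNeg n L)
    (hL1 : L 1 = 0) (hLstar : ∀ x : Mat n, L xᴴ = (L x)ᴴ) {t : ℝ} (ht : 0 ≤ t) :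
    IsCompletelyPositive n (expEnd n ((t : ℂ) • (-L))) := by
  rw [isCompletelyPositive_iff_blockForm_nonneg]
  intro k hk X hX w
  rcases Nat.eq_zero_or_pos n with rfl | hn
  · simp [blockForm_apply]
  have : NeZero n := ⟨hn.ne'⟩
  refine ge_of_tendsto' (tendsto_apply_pow_expEnd (blockForm n k X w) (-L)
    (LinearMap.mulLeft ℂ (driftMatrix L 0) * LinearMap.mulRight ℂ (driftMatrix L 0)ᴴ) ht)
    fun m => ?_
  exact isCompletelyPositive_iff_blockForm_nonneg.1
    ((hL.isCompletelyPositive_euler hL1 hLstar (0 : Fin n) (by positivity)).pow_s2 m) k hk X hX w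

open Filter Topology in
theorem condNeg_of_isCompletelyPositive_expEnd {n : ℕ} {L : Mat n →ₗ[ℂ] Mat n}
    (h : ∀ t : ℝ, 0 ≤ t → IsCompletelyPositive n (expEnd n ((t : ℂ) • (-L)))) :
    CondNeg n L := by
  intro m x y hxy
  rcases Nat.eq_zero_or_pos m with rfl | hm
  · simpa using Matrix.PosSemidef.zero
  refine posSemidef_of_forall_nonneg fun u => ?_
  let B : Matrix (Fin n) (Fin m × Fin n) ℂ := Matrix.of fun i q => x q.1 i q.2
  let w : Fin m × Fin n → ℂ := fun q => (y q.1 *ᵥ u) q.2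
  let ℓ := blockForm n m (Bᴴ * B) w
  have hblock : ∀ j l, (Matrix.of fun i i' => (Bᴴ * B) (j, i) (l, i')) = (x j)ᴴ * x l := by
    intro j l
    ext i i'
    simp [B, Matrix.mul_apply]
  have hℓ : ∀ Φ, ℓ Φ = star u ⬝ᵥ ((∑ j, ∑ l, (y j)ᴴ * Φ ((x j)ᴴ * x l) * y l) *ᵥ u) := by
    intro Φ
    simp only [ℓ, blockForm_apply, hblock, Matrix.sum_mulVec, dotProduct_sum]
    refine Finset.sum_congr rfl fun j _ => Finset.sum_congr rfl fun l _ => ?_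
    change star (y j *ᵥ u) ⬝ᵥ (_ *ᵥ (y l *ᵥ u)) = _
    rw [Matrix.star_mulVec, ← Matrix.dotProduct_mulVec, Matrix.mulVec_mulVec,
      Matrix.mulVec_mulVec]
  have hone : ℓ 1 = 0 := by
    have : ∑ j, ∑ l, (y j)ᴴ * ((x j)ᴴ * x l) * y l = (∑ j, x j * y j)ᴴ * ∑ j, x j * y j := by
      rw [Matrix.conjTranspose_sum, Finset.sum_mul_sum]
      simp [Matrix.mul_assoc]
    rw [hℓ]
    simp [this, hxy]
  have hneg : star u ⬝ᵥ (-(∑ j, ∑ l, (y j)ᴴ * L ((x j)ᴴ * x l) * y l) *ᵥ u) = ℓ (-L) := by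
    rw [map_neg, hℓ, Matrix.neg_mulVec, dotProduct_neg]
  rw [hneg]
  have h0 : ℓ (expEnd n (((0 : ℝ) : ℂ) • (-L))) = 0 := by
    have : expEnd n (((0 : ℝ) : ℂ) • (-L)) = 1 := by
      apply (endEquivCLM n).injective
      rw [endEquivCLM_expEnd]
      simp
    rw [this, hone]
  refine ge_of_tendsto (hasDerivAt_apply_expEnd ℓ (-L)).tendsto_slope_zero_right ?_
  filter_upwards [self_mem_nhdsWithin] with t ht
  rw [h0, zero_add, sub_zero]
  have ht0 : 0 ≤ t := le_of_lt ht
  exact smul_nonneg (inv_nonneg.2 ht0) (isCompletelyPositive_iff_blockForm_nonneg.1 (h t ht0) m hm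
    _ (Matrix.posSemidef_conjTranspose_mul_self B) w)

/-- **Characterization of generators of quantum Markov semigroups.**
For a linear map `L` on `M_n(ℂ)` with `L(1) = 0` and `L(x*) = L(x)*`, the semigroup
`exp(−tL)` consists of unital completely positive maps for all `t ≥ 0` iff `L` is
conditionally negative. -/
theorem generator_CP_iff_condNeg {n : ℕ} (L : Mat n →ₗ[ℂ] Mat n)
    (hL1 : L 1 = 0) (hLstar : ∀ x : Mat n, L xᴴ = (L x)ᴴ) :
    (∀ t : ℝ, 0 ≤ t →
        IsCompletelyPositive n (expEnd n (-((t : ℂ) • L))) ∧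
        (expEnd n (-((t : ℂ) • L))) 1 = 1) ↔
      CondNeg n L := by
  have hneg : ∀ t : ℂ, -(t • L) = t • (-L) := fun t => (smul_neg t L).symm
  simp only [hneg]
  refine ⟨fun h => condNeg_of_isCompletelyPositive_expEnd fun t ht => (h t ht).1, fun h t ht => ?_⟩
  exact ⟨h.isCompletelyPositive_expEnd hL1 hLstar ht,
    expEnd_apply_of_apply_eq_zero (by simp [hL1]) ht⟩
end
end
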